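/- arXiv:2601.05096 — 8 statements merged into one kernel-verified Lean document; each statement's English description precedes it below -/
import Mathlib

section
/- Let K be a field of characteristic 0, σ : K → K a field automorphism, L an algebraic field extension of K, and τ : L → L a field automorphism extending σ (i.e. τ(ι(x)) = ι(σ(x)) for all x ∈ K, where ι : K → L is the embedding). Let a ∈ K. If the equation σ(x) − x = a has no solution x in K, then the equation τ(x) − x = ι(a) has no solution x in L. -/
open Polynomial in
/-- The subleading coefficient of a Taylor shift. -/
lemma coeff_taylor_of_natDegree_eq_succ {R : Type*} [CommRing R] (r : R) (p : R[X]) (m : ℕ)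
    (hp : p.natDegree = m + 1) :
    (taylor r p).coeff m = p.coeff m + (m + 1) * p.leadingCoeff * r := by
  have hdeg : (hasseDeriv m p).natDegree < 2 := by
    have := natDegree_hasseDeriv_le p m
    omega
  rw [taylor_coeff, eval_eq_sum_range' hdeg, Finset.sum_range_succ, Finset.sum_range_one,
    hasseDeriv_coeff, hasseDeriv_coeff, leadingCoeff, hp, add_comm 1 m]
  simp

open Polynomial in
/-- A field isomorphism extending `σ` sends minimal polynomials to their `σ`-conjugates. -/
lemma minpoly_apply_of_extends {K L : Type*} [Field K] [Field L] [Algebra K L]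
    (σ : K ≃+* K) (τ : L ≃+* L)
    (hτσ : ∀ x : K, τ (algebraMap K L x) = algebraMap K L (σ x)) {x : L} (hx : IsIntegral K x) :
    minpoly K (τ x) = (minpoly K x).map (σ : K →+* K) := by
  have hcomp : (τ : L →+* L).comp (algebraMap K L) = (algebraMap K L).comp (σ : K →+* K) :=
    RingHom.ext hτσ
  refine (minpoly.eq_of_irreducible_of_monic ?_ ?_ ((minpoly.monic hx).map _)).symm
  · exact (MulEquiv.irreducible_iff (mapEquiv σ)).2 (minpoly.irreducible hx)
  · have h : eval₂ ((τ : L →+* L).comp (algebraMap K L)) (τ x) (minpoly K x) = 0 := by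
      have h := hom_eval₂ (minpoly K x) (algebraMap K L) (τ : L →+* L) x
      rw [← aeval_def, minpoly.aeval, map_zero] at h
      exact h.symm
    rw [aeval_def, eval₂_map, ← hcomp, h]

/-- If the σ-AS equation `σ(x) - x = a` has no solution in a characteristic-zero
field `K`, then it has no solution in any algebraic extension `L` of `K`
(with respect to any automorphism `τ` of `L` extending `σ`). -/
theorem sigmaAS_not_solvable_in_algebraic_extension
    {K L : Type*} [Field K] [Field L] [CharZero K]
    [Algebra K L] [Algebra.IsAlgebraic K L]
    (σ : K ≃+* K) (τ : L ≃+* L)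
    (hτσ : ∀ x : K, τ (algebraMap K L x) = algebraMap K L (σ x))
    (a : K)
    (hK : ¬ ∃ x : K, σ x - x = a) :
    ¬ ∃ x : L, τ x - x = algebraMap K L a := by
  rintro ⟨x, hx⟩
  have hint : IsIntegral K x := Algebra.IsIntegral.isIntegral x
  obtain ⟨m, hm⟩ := Nat.exists_eq_add_one_of_ne_zero (minpoly.natDegree_pos hint).ne'
  have hshift : minpoly K (τ x) = Polynomial.taylor (-a) (minpoly K x) := by
    rw [sub_eq_iff_eq_add'.1 hx, minpoly.add_algebraMap, Polynomial.taylor_apply, map_neg,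
      sub_eq_add_neg]
  have hcoeff := congrArg (fun p => p.coeff m)
    ((minpoly_apply_of_extends σ τ hτσ hint).symm.trans hshift)
  simp only [Polynomial.coeff_map, coeff_taylor_of_natDegree_eq_succ _ _ m hm,
    (minpoly.monic hint).leadingCoeff, RingHom.coe_coe] at hcoeff
  have hne : (m + 1 : K) ≠ 0 := Nat.cast_add_one_ne_zero m
  refine hK ⟨-(minpoly K x).coeff m / (m + 1), ?_⟩
  rw [map_div₀, map_neg, hcoeff, map_add, map_natCast, map_one]
  field_simp
  ring
end

section
/- Let K be a field of characteristic 0, σ : K → K a field automorphism, L an algebraic field extension of K, and τ : L → L a field automorphism extending σ (i.e. τ(ι(x)) = ι(σ(x)) for all x ∈ K, where ι : K → L is the embedding). Let e₁, e₂ ∈ K with e₁ ≠ 0 and e₂ ≠ 0. If the twisted σ-AS equation σ(x) − e₁·x = e₂ has no solution x in K, then the equation τ(x) − ι(e₁)·x = ι(e₂) has no solution x in L. -/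
/-- The normalized trace commutes with a ring automorphism of the extension that restricts to one
of the base field. -/
theorem Algebra.normalizedTrace_ringEquiv_apply {K L : Type*} [Field K] [Field L] [CharZero K]
    [Algebra K L] [Algebra.IsAlgebraic K L] (σ : K ≃+* K) (τ : L ≃+* L)
    (hτσ : ∀ x : K, τ (algebraMap K L x) = algebraMap K L (σ x)) (x : L) :
    normalizedTrace K L (τ x) = σ (normalizedTrace K L x) := by
  have hcomp : (algebraMap K L).comp (σ : K →+* K) = (τ : L →+* L).comp (algebraMap K L) :=
    RingHom.ext fun y => (hτσ y).symm
  have hmin : (minpoly K x).map (σ : K →+* K) = minpoly K (τ x) :=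
    minpoly.map_eq_of_equiv_equiv hcomp x
  simp [normalizedTrace_minpoly, ← hmin, Polynomial.nextCoeff_map_eq]

/-- If the twisted σ-AS equation `σ(x) - e₁·x = e₂` (with `e₁, e₂ ≠ 0`) has no
solution in a characteristic-zero field `K`, then it has no solution in any
algebraic extension `L` of `K` (with respect to any automorphism `τ` of `L`
extending `σ`). -/
theorem twisted_sigmaAS_not_solvable_in_algebraic_extension
    {K L : Type*} [Field K] [Field L] [CharZero K]
    [Algebra K L] [Algebra.IsAlgebraic K L]
    (σ : K ≃+* K) (τ : L ≃+* L)
    (hτσ : ∀ x : K, τ (algebraMap K L x) = algebraMap K L (σ x))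
    (e₁ e₂ : K) (he₁ : e₁ ≠ 0) (he₂ : e₂ ≠ 0)
    (hK : ¬ ∃ x : K, σ x - e₁ * x = e₂) :
    ¬ ∃ x : L, τ x - algebraMap K L e₁ * x = algebraMap K L e₂ := by
  rintro ⟨x, hx⟩
  refine hK ⟨Algebra.normalizedTrace K L x, ?_⟩
  have h := congrArg (Algebra.normalizedTrace K L) hx
  rwa [map_sub, Algebra.normalizedTrace_ringEquiv_apply σ τ hτσ, ← Algebra.smul_def, map_smul,
    smul_eq_mul, Algebra.normalizedTrace_algebraMap_apply K K L,
    Algebra.normalizedTrace_self_apply] at h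
end

section
/- Let E be a field of characteristic 0, σ₀ : E → E a field automorphism, f ∈ E, and e ∈ E with e ≠ 0. Let σ̂ be a field automorphism of the rational function field E(X) such that σ̂(C(c)) = C(σ₀(c)) for all c ∈ E and σ̂(X) = X + C(f), where C : E → E(X) is the constant embedding and X the distinguished generator. If for some integer z ≠ 0 there exists b ∈ E(X) with b ≠ 0 and σ̂(b) = C(e)^z·b, then there exists c ∈ E with c ≠ 0 and σ₀(c) = e^z·c. -/
open Polynomial in
/-- An endomorphism of `E(X)` extending `σ₀` with `X ↦ X + C f` acts on polynomials by applying
`σ₀` to the coefficients and then translating by `f`. -/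
lemma RatFunc.map_algebraMap_of_map_X_eq_X_add_C {E : Type*} [Field E]
    (σ₀ : E →+* E) (f : E) (σhat : RatFunc E →+* RatFunc E)
    (hC : ∀ c : E, σhat (RatFunc.C c) = RatFunc.C (σ₀ c))
    (hX : σhat RatFunc.X = RatFunc.X + RatFunc.C f) (p : E[X]) :
    σhat (algebraMap E[X] (RatFunc E) p) =
      algebraMap E[X] (RatFunc E) ((p.map σ₀).comp (Polynomial.X + Polynomial.C f)) := by
  induction p using Polynomial.induction_on' with
  | add p q hp hq => simp [hp, hq]
  | monomial n a => simp [← C_mul_X_pow_eq_monomial, hC, hX]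

open Polynomial in
lemma Polynomial.leadingCoeff_map_comp_X_add_C {E : Type*} [Field E]
    (σ₀ : E →+* E) (f : E) (p : E[X]) :
    ((p.map σ₀).comp (X + C f)).leadingCoeff = σ₀ p.leadingCoeff := by
  rw [leadingCoeff_comp (by simp)]
  simp

/-- Let `σhat` be an automorphism of the rational function field `E(X)` extending
an automorphism `σ₀` of `E` and sending `X` to `X + C(f)`. If for some nonzero
integer `z` the equation `σhat(b) = C(e)^z · b` has a nonzero solution `b ∈ E(X)`,
then the equation `σ₀(c) = e^z · c` already has a nonzero solution `c ∈ E`. -/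
theorem multiplicative_solution_in_ratFunc_descends
    {E : Type*} [Field E] [CharZero E]
    (σ₀ : E ≃+* E) (f e : E) (he : e ≠ 0)
    (σhat : RatFunc E ≃+* RatFunc E)
    (hC : ∀ c : E, σhat (RatFunc.C c) = RatFunc.C (σ₀ c))
    (hX : σhat RatFunc.X = RatFunc.X + RatFunc.C f)
    (z : ℤ) (hz : z ≠ 0)
    (hb : ∃ b : RatFunc E, b ≠ 0 ∧ σhat b = (RatFunc.C e) ^ z * b) :
    ∃ c : E, c ≠ 0 ∧ σ₀ c = e ^ z * c := by
  obtain ⟨b, hb0, hb⟩ := hb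
  refine ⟨b.num.leadingCoeff, by simpa using hb0, ?_⟩
  have hS := RatFunc.map_algebraMap_of_map_X_eq_X_add_C (σ₀ : E →+* E) f
    (σhat : RatFunc E →+* RatFunc E) hC hX
  simp only [RingHom.coe_coe] at hS
  have hq : algebraMap (Polynomial E) (RatFunc E) b.denom ≠ 0 :=
    RatFunc.algebraMap_ne_zero b.denom_ne_zero
  have hσq : σhat (algebraMap (Polynomial E) (RatFunc E) b.denom) ≠ 0 := by simpa using hq
  rw [← map_zpow₀, ← RatFunc.num_div_denom b, map_div₀, ← mul_div_assoc,
    div_eq_div_iff hσq hq, hS, hS, ← RatFunc.algebraMap_C, ← map_mul, ← map_mul, ← map_mul] at hb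
  have h := congrArg Polynomial.leadingCoeff (RatFunc.algebraMap_injective E hb)
  simpa [Polynomial.leadingCoeff_mul, Polynomial.leadingCoeff_map_comp_X_add_C,
    b.monic_denom.leadingCoeff] using h
end

section
/- Let E be a field of characteristic 0, σ₀ : E → E a field automorphism, f ∈ E, and g ∈ E with g ≠ 0. Let σ̂ be a field automorphism of the rational function field E(X) such that σ̂(C(c)) = C(σ₀(c)) for all c ∈ E and σ̂(X) = X + C(f), where C : E → E(X) is the constant embedding and X the distinguished generator. If there exists b ∈ E(X) with σ̂(b) − C(g)·b = C(g), then either there exists c ∈ E with c ≠ 0 and σ₀(c) = g·c, or there exists c ∈ E with σ₀(c) − g·c = g. -/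
namespace Polynomial

/-- The ring endomorphism of `E[X]` acting by `σ` on coefficients and sending `X` to `X + C f`. -/
noncomputable def twistedShift {E : Type*} [Field E] (σ : E →+* E) (f : E) : E[X] →+* E[X] :=
  (compRingHom (X + C f)).comp (mapRingHom σ)

variable {E : Type*} [Field E] (σ : E →+* E) (f : E)

theorem twistedShift_apply (p : E[X]) : twistedShift σ f p = (p.map σ).comp (X + C f) := rfl

theorem natDegree_twistedShift (p : E[X]) : (twistedShift σ f p).natDegree = p.natDegree := by
  rw [twistedShift_apply, natDegree_comp, natDegree_X_add_C, mul_one, natDegree_map]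

theorem leadingCoeff_twistedShift (p : E[X]) :
    (twistedShift σ f p).leadingCoeff = σ p.leadingCoeff := by
  rw [twistedShift_apply, leadingCoeff_comp (by simp), leadingCoeff_X_add_C, one_pow, mul_one,
    leadingCoeff_map]

theorem twistedShift_injective : Function.Injective (twistedShift σ f) := by
  rw [injective_iff_map_eq_zero]
  intro p hp
  rwa [← leadingCoeff_eq_zero, leadingCoeff_twistedShift, map_eq_zero, leadingCoeff_eq_zero] at hp

theorem degree_twistedShift (p : E[X]) : (twistedShift σ f p).degree = p.degree := by
  rcases eq_or_ne p 0 with rfl | hp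
  · simp
  · rw [degree_eq_natDegree hp, degree_eq_natDegree ((map_ne_zero_iff _
      (twistedShift_injective σ f)).2 hp), natDegree_twistedShift]

/-- The polynomial part of a fraction `p / q` solving the twisted equation solves it too. -/
theorem twistedShift_divByMonic_eq {g : E} {p q : E[X]} (hq : q.Monic)
    (h : twistedShift σ f p * q - C g * p * twistedShift σ f q = C g * q * twistedShift σ f q) :
    twistedShift σ f (p /ₘ q) - C g * (p /ₘ q) = C g := by
  have hp := modByMonic_add_div p q
  have hp' : twistedShift σ f p = twistedShift σ f (p %ₘ q) +
      twistedShift σ f q * twistedShift σ f (p /ₘ q) := by rw [← map_mul, ← map_add, hp]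
  have hr : (p %ₘ q).degree < q.degree := degree_modByMonic_lt p hq
  have hrτ := degree_twistedShift σ f (p %ₘ q)
  have hqτ := degree_twistedShift σ f q
  have hq0 : q.degree ≠ ⊥ := degree_ne_bot.2 hq.ne_zero
  generalize p %ₘ q = r at *
  generalize p /ₘ q = d at *
  generalize twistedShift σ f p = p', twistedShift σ f q = q', twistedShift σ f r = r',
    twistedShift σ f d = d' at *
  have key : (d' - C g * d - C g) * (q * q') = C g * r * q' - r' * q := by
    linear_combination h - q * hp' - C g * q' * hp
  have hrq : r.degree + q.degree < q.degree + q.degree := WithBot.add_lt_add_right hq0 hr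
  have hlt : (C g * r * q' - r' * q).degree < (q * q').degree := by
    rw [degree_mul, hqτ]
    refine (degree_sub_le _ _).trans_lt (max_lt ?_ ?_)
    · refine lt_of_le_of_lt ?_ hrq
      rw [degree_mul, degree_mul, hqτ]
      gcongr
      exact add_le_of_nonpos_left degree_C_le
    · rwa [degree_mul, hrτ]
  by_contra hne
  rw [← key, mul_comm] at hlt
  exact hlt.not_ge (degree_le_mul_left _ (sub_ne_zero.2 hne))

/-- A polynomial solution of the twisted equation yields a solution of the homogeneous or of the
inhomogeneous equation in the coefficient field. -/
theorem exists_of_twistedShift_sub_eq {g : E} {a : E[X]}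
    (h : twistedShift σ f a - C g * a = C g) :
    (∃ c : E, c ≠ 0 ∧ σ c = g * c) ∨ (∃ c : E, σ c - g * c = g) := by
  rcases eq_or_ne a.natDegree 0 with h0 | h0
  · obtain ⟨c, rfl⟩ := natDegree_eq_zero.1 h0
    right
    refine ⟨c, C_injective ?_⟩
    simpa [twistedShift_apply] using h
  · left
    refine ⟨a.leadingCoeff, leadingCoeff_ne_zero.2 (by rintro rfl; simp at h0), ?_⟩
    have := congrArg (fun b => coeff b a.natDegree) h
    simp only [coeff_sub, coeff_C_mul, coeff_C_of_ne_zero h0] at this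
    rw [← leadingCoeff_twistedShift σ f, leadingCoeff, natDegree_twistedShift]
    exact sub_eq_zero.1 this

end Polynomial

open Polynomial in
theorem RatFunc.map_algebraMap_eq_twistedShift {E : Type*} [Field E] (σ : E →+* E) (f : E)
    (φ : RatFunc E →+* RatFunc E) (hC : ∀ c : E, φ (RatFunc.C c) = RatFunc.C (σ c))
    (hX : φ RatFunc.X = RatFunc.X + RatFunc.C f) (p : E[X]) :
    φ (algebraMap E[X] (RatFunc E) p) = algebraMap E[X] (RatFunc E) (twistedShift σ f p) := by
  suffices φ.comp (algebraMap E[X] (RatFunc E)) =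
      (algebraMap E[X] (RatFunc E)).comp (twistedShift σ f) from RingHom.congr_fun this p
  refine Polynomial.ringHom_ext (fun c => ?_) ?_
  · simp [twistedShift_apply, hC]
  · simp [twistedShift_apply, hX]

/-- Let `σhat` be an automorphism of the rational function field `E(X)` extending
an automorphism `σ₀` of `E` and sending `X` to `X + C(f)`. If the twisted σ-AS
equation `σhat(b) - C(g)·b = C(g)` (with `g ≠ 0`) has a solution `b ∈ E(X)`, then
either `σ₀(c) = g·c` has a nonzero solution in `E`, or `σ₀(c) - g·c = g` has a
solution in `E`. -/
theorem twisted_sigmaAS_solution_in_ratFunc_descends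
    {E : Type*} [Field E] [CharZero E]
    (σ₀ : E ≃+* E) (f g : E) (hg : g ≠ 0)
    (σhat : RatFunc E ≃+* RatFunc E)
    (hC : ∀ c : E, σhat (RatFunc.C c) = RatFunc.C (σ₀ c))
    (hX : σhat RatFunc.X = RatFunc.X + RatFunc.C f)
    (hb : ∃ b : RatFunc E, σhat b - RatFunc.C g * b = RatFunc.C g) :
    (∃ c : E, c ≠ 0 ∧ σ₀ c = g * c) ∨ (∃ c : E, σ₀ c - g * c = g) := by
  obtain ⟨b, hb⟩ := hb
  refine Polynomial.exists_of_twistedShift_sub_eq (σ₀ : E →+* E) f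
    (Polynomial.twistedShift_divByMonic_eq _ f (p := b.num) b.monic_denom ?_)
  have hσ := RatFunc.map_algebraMap_eq_twistedShift (σ₀ : E →+* E) f
    (σhat : RatFunc E →+* RatFunc E) hC hX
  simp only [RingEquiv.coe_toRingHom] at hσ
  have hd : algebraMap _ (RatFunc E) b.denom ≠ 0 := RatFunc.algebraMap_ne_zero b.denom_ne_zero
  have hd' := (map_ne_zero σhat).2 hd
  rw [← b.num_div_denom, map_div₀] at hb
  rw [hσ] at hd'
  rw [hσ, hσ] at hb
  field_simp at hb
  apply RatFunc.algebraMap_injective E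
  simp only [map_sub, map_mul, RatFunc.algebraMap_C]
  linear_combination hb
end

section
/- Let L be a field of characteristic 0, E a subfield of L, and a ∈ L transcendental over E such that L is algebraic over the subfield E(a) generated by E and a. Let τ : L → L be a field automorphism with τ(E) = E, write σ₀ for the restriction of τ to E, and assume τ(a) = a + f for some f ∈ E. Let e ∈ E with e ≠ 0 and assume: (i) for every integer z ≠ 0 there is no c ∈ E ∖ {0} with σ₀(c) = e^z·c; (ii) there is no c ∈ E with σ₀(c) − e·c = e; (iii) there is no c ∈ E with σ₀(c) − e⁻¹·c = e⁻¹. Then the same holds in L: (i') for every integer z ≠ 0 there is no b ∈ L ∖ {0} with τ(b) = e^z·b; (ii') there is no b ∈ L with τ(b) − e·b = e; (iii') there is no b ∈ L with τ(b) − e⁻¹·b = e⁻¹. -/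
open Polynomial in
/-- The minimal polynomial of `b` is determined up to a scalar by an affine semilinear relation
`τ b = u * b + v`. -/
theorem minpoly_map_comp_of_affine {K L : Type*} [Field K] [Field L] [Algebra K L]
    (σ : K →+* K) (τ : L →+* L) (hστ : ∀ x, τ (algebraMap K L x) = algebraMap K L (σ x))
    {b : L} (hb : IsIntegral K b) {u v : K} (hu : u ≠ 0)
    (h : τ b = algebraMap K L u * b + algebraMap K L v) :
    ((minpoly K b).map σ).comp (C u * X + C v) =
      C (u ^ (minpoly K b).natDegree) * minpoly K b := by
  set p := minpoly K b with hp
  have hmon : p.Monic := minpoly.monic hb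
  have hlin : (C u * X + C v).natDegree = 1 := natDegree_linear hu
  have hdeg : ((p.map σ).comp (C u * X + C v)).natDegree = p.natDegree := by
    rw [natDegree_comp, hlin, natDegree_map, mul_one]
  have hlead : ((p.map σ).comp (C u * X + C v)).leadingCoeff = u ^ p.natDegree := by
    rw [leadingCoeff_comp (by rw [hlin]; exact one_ne_zero), (hmon.map σ).leadingCoeff,
      natDegree_map, leadingCoeff_linear hu, one_mul]
  have hroot : aeval b ((p.map σ).comp (C u * X + C v)) = 0 := by
    have hcomm : (algebraMap K L).comp σ = τ.comp (algebraMap K L) := by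
      ext x; exact (hστ x).symm
    have h0 : τ (aeval b p) = 0 := by rw [hp, minpoly.aeval, map_zero]
    rw [aeval_comp]
    simp only [map_add, map_mul, aeval_C, aeval_X]
    rw [← h, aeval_def, eval₂_map, hcomm, ← hom_eval₂]
    exact h0
  obtain ⟨q, hq⟩ := minpoly.dvd K b hroot
  rw [← hp] at hq
  have hne : (p.map σ).comp (C u * X + C v) ≠ 0 := by
    intro h0
    rw [h0, leadingCoeff_zero] at hlead
    exact pow_ne_zero _ hu hlead.symm
  have hq0 : q ≠ 0 := by rintro rfl; exact hne (by rw [hq, mul_zero])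
  have hqdeg : q.natDegree = 0 := by
    have := hdeg
    rw [hq, natDegree_mul hmon.ne_zero hq0] at this
    omega
  rw [hq, leadingCoeff_mul, hmon.leadingCoeff, one_mul, leadingCoeff, hqdeg] at hlead
  rw [hq, eq_C_of_natDegree_eq_zero hqdeg, hlead, mul_comm]

open Polynomial in
/-- A nonzero algebraic solution of `τ b = u * b` yields a solution of a power of this
multiplicative equation in the base field. -/
theorem exists_base_multiplicative_solution {K L : Type*} [Field K] [Field L] [Algebra K L]
    (σ : K →+* K) (τ : L →+* L) (hστ : ∀ x, τ (algebraMap K L x) = algebraMap K L (σ x))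
    {b : L} (hb : IsIntegral K b) (hb0 : b ≠ 0) {u : K} (hu : u ≠ 0)
    (h : τ b = algebraMap K L u * b) :
    ∃ n : ℕ, n ≠ 0 ∧ ∃ c : K, c ≠ 0 ∧ σ c = u ^ n * c := by
  refine ⟨(minpoly K b).natDegree, (minpoly.natDegree_pos hb).ne', (minpoly K b).coeff 0,
    minpoly.coeff_zero_ne_zero hb hb0, ?_⟩
  have key := minpoly_map_comp_of_affine σ τ hστ hb (v := 0) hu (by rw [h, map_zero, add_zero])
  simpa [coeff_zero_eq_eval_zero, eval_comp, eval_map, eval₂_at_zero] using congrArg (eval 0) key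

open Polynomial in
/-- In characteristic zero, an algebraic solution of `τ b = u * b + v` yields a solution in the
base field, namely a normalized trace. -/
theorem exists_base_affine_solution {K L : Type*} [Field K] [CharZero K] [Field L] [Algebra K L]
    (σ : K →+* K) (τ : L →+* L) (hστ : ∀ x, τ (algebraMap K L x) = algebraMap K L (σ x))
    {b : L} (hb : IsIntegral K b) {u v : K} (hu : u ≠ 0)
    (h : τ b = algebraMap K L u * b + algebraMap K L v) :
    ∃ c : K, σ c = u * c + v := by
  have key := minpoly_map_comp_of_affine σ τ hστ hb hu h
  have hmon : (minpoly K b).Monic := minpoly.monic hb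
  obtain ⟨n, hn⟩ : ∃ n, (minpoly K b).natDegree = n + 1 :=
    Nat.exists_eq_succ_of_ne_zero (minpoly.natDegree_pos hb).ne'
  set p := minpoly K b
  have hcomp : (p.map σ).comp (C u * X + C v) = ((taylor v (p.map σ)).comp (C u * X)) := by
    rw [taylor_apply, comp_assoc]; simp
  have hc := congrArg (fun q => q.coeff n) key
  have hn' : (n + 1 : K) ≠ 0 := by exact_mod_cast n.succ_ne_zero
  have htaylor : (taylor v (p.map σ)).coeff n = σ (p.coeff n) + (n + 1) * v := by
    have hd : (hasseDeriv n (p.map σ)).natDegree ≤ 1 :=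
      (natDegree_hasseDeriv_le _ _).trans (by rw [natDegree_map, hn]; omega)
    have h1 : p.coeff (n + 1) = 1 := by rw [← hn]; exact hmon
    rw [taylor_coeff, eq_X_add_C_of_natDegree_le_one hd]
    simp [hasseDeriv_coeff, add_comm 1 n, h1]
    ring
  simp only [hcomp, comp_C_mul_X_coeff, htaylor, hn, coeff_C_mul] at hc
  refine ⟨-p.coeff n / (n + 1), ?_⟩
  have hun := pow_ne_zero n hu
  have h2 : σ (p.coeff n) + (n + 1) * v = u * p.coeff n :=
    mul_right_cancel₀ hun (by rw [hc]; ring)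
  simp only [map_div₀, map_neg, map_add, map_natCast, map_one]
  field_simp
  linear_combination -h2

open Polynomial in
/-- The action of `τ` on polynomial expressions in `a` when `τ a = a + f`. -/
theorem map_aeval_eq_aeval_taylor {k L : Type*} [Field k] [Field L] [Algebra k L]
    (σ : k →+* k) (τ : L →+* L) (hστ : ∀ x, τ (algebraMap k L x) = algebraMap k L (σ x))
    {a : L} {f : k} (ha : τ a = a + algebraMap k L f) (p : k[X]) :
    τ (aeval a p) = aeval a (taylor f (p.map σ)) := by
  have hcomm : (algebraMap k L).comp σ = τ.comp (algebraMap k L) := by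
    ext x; exact (hστ x).symm
  rw [taylor_apply, aeval_comp, map_add, aeval_X, aeval_C, ← ha, aeval_def, aeval_def, eval₂_map,
    hcomm, ← hom_eval₂]

open Polynomial in
/-- Clearing denominators in `τ x = u * x + v` for `x` a rational expression in `a`. -/
theorem taylor_mul_eq_of_affine {k L : Type*} [Field k] [Field L] [Algebra k L]
    (σ : k →+* k) (τ : L →+* L) (hστ : ∀ x, τ (algebraMap k L x) = algebraMap k L (σ x))
    {a : L} (hat : Transcendental k a) {f : k} (ha : τ a = a + algebraMap k L f)
    {p q : k[X]} (hq : q ≠ 0) {u v : k}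
    (h : τ (aeval a p / aeval a q) =
      algebraMap k L u * (aeval a p / aeval a q) + algebraMap k L v) :
    taylor f (p.map σ) * q = C u * (p * taylor f (q.map σ)) + C v * (q * taylor f (q.map σ)) := by
  have hinj := transcendental_iff_injective.mp hat
  have hq0 : aeval a q ≠ 0 := fun h0 => hq (hinj (by rw [h0, map_zero]))
  have hτq := map_aeval_eq_aeval_taylor σ τ hστ ha q
  have hq1 : aeval a (taylor f (q.map σ)) ≠ 0 := by
    rw [← hτq]; exact (map_ne_zero τ).mpr hq0
  rw [map_div₀, hτq, map_aeval_eq_aeval_taylor σ τ hστ ha p] at h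
  apply hinj
  simp only [map_add, map_mul, aeval_C]
  field_simp at h
  linear_combination h

open Polynomial in
/-- A nonzero solution of `τ x = u * x` in `k(a)` yields one in `k`. -/
theorem exists_multiplicative_solution_of_mem_adjoin {k L : Type*} [Field k] [Field L] [Algebra k L]
    (σ : k →+* k) (τ : L →+* L) (hστ : ∀ x, τ (algebraMap k L x) = algebraMap k L (σ x))
    {a : L} (hat : Transcendental k a) {f : k} (ha : τ a = a + algebraMap k L f)
    {x : L} (hx : x ∈ IntermediateField.adjoin k {a}) (hx0 : x ≠ 0) {u : k}
    (h : τ x = algebraMap k L u * x) : ∃ c : k, c ≠ 0 ∧ σ c = u * c := by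
  obtain ⟨p, q, rfl⟩ := (IntermediateField.mem_adjoin_simple_iff k x).mp hx
  have hp : p ≠ 0 := by rintro rfl; simp at hx0
  have hq : q ≠ 0 := by rintro rfl; simp at hx0
  have key := taylor_mul_eq_of_affine σ τ hστ hat ha (p := p) hq (u := u) (v := 0)
    (by rw [h, map_zero, add_zero])
  have hl := congrArg leadingCoeff key
  simp only [C_0, zero_mul, add_zero, leadingCoeff_mul, leadingCoeff_C, leadingCoeff_taylor,
    leadingCoeff_map] at hl
  have hp0 := leadingCoeff_ne_zero.mpr hp
  have hq0 := leadingCoeff_ne_zero.mpr hq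
  have hσ := (map_ne_zero σ).mpr hq0
  refine ⟨p.leadingCoeff / q.leadingCoeff, div_ne_zero hp0 hq0, ?_⟩
  rw [map_div₀]
  field_simp
  linear_combination hl

open Polynomial in
/-- A solution of `τ x = u * x + v` in `k(a)` yields a solution in `k` of this equation or a nonzero
solution of the associated homogeneous one. -/
theorem exists_solution_of_mem_adjoin {k L : Type*} [Field k] [Field L] [Algebra k L]
    (σ : k →+* k) (τ : L →+* L) (hστ : ∀ x, τ (algebraMap k L x) = algebraMap k L (σ x))
    {a : L} (hat : Transcendental k a) {f : k} (ha : τ a = a + algebraMap k L f)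
    {x : L} (hx : x ∈ IntermediateField.adjoin k {a}) {u v : k}
    (h : τ x = algebraMap k L u * x + algebraMap k L v) :
    (∃ c : k, c ≠ 0 ∧ σ c = u * c) ∨ ∃ c : k, σ c = u * c + v := by
  obtain ⟨p, q, rfl⟩ := (IntermediateField.mem_adjoin_simple_iff k x).mp hx
  by_cases hq : q = 0
  · subst hq
    have hv : v = 0 := by simpa using h.symm
    exact Or.inr ⟨0, by simp [hv]⟩
  have key := taylor_mul_eq_of_affine σ τ hστ hat ha (p := p) hq h
  have hq0 := leadingCoeff_ne_zero.mpr hq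
  have hσ := (map_ne_zero σ).mpr hq0
  have hqd : (taylor f (q.map σ)).natDegree = q.natDegree := by
    rw [natDegree_taylor, natDegree_map]
  have hqc : (taylor f (q.map σ)).coeff q.natDegree = σ q.leadingCoeff := by
    have := leadingCoeff_taylor (r := f) (f := q.map σ)
    rwa [leadingCoeff, hqd, leadingCoeff_map] at this
  have top : ∀ m, p.natDegree ≤ m → q.natDegree ≤ m →
      σ (p.coeff m / q.leadingCoeff) =
        u * (p.coeff m / q.leadingCoeff) + v * (q.coeff m / q.leadingCoeff) := by
    intro m hpm hqm
    have hpd : (taylor f (p.map σ)).natDegree ≤ m := by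
      rwa [natDegree_taylor, natDegree_map]
    have hpc : (taylor f (p.map σ)).coeff m = σ (p.coeff m) := by
      rw [taylor_coeff]
      have hd : (hasseDeriv m (p.map σ)).natDegree ≤ 0 :=
        (natDegree_hasseDeriv_le _ _).trans (by rw [natDegree_map]; omega)
      rw [eq_C_of_natDegree_le_zero hd]
      simp [hasseDeriv_coeff]
    have hc := congrArg (fun r => r.coeff (m + q.natDegree)) key
    simp only [coeff_add, coeff_C_mul,
      coeff_mul_add_eq_of_natDegree_le hpd le_rfl,
      coeff_mul_add_eq_of_natDegree_le hpm hqd.le,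
      coeff_mul_add_eq_of_natDegree_le hqm hqd.le, hpc, hqc, coeff_natDegree] at hc
    rw [map_div₀]
    field_simp
    linear_combination hc
  rcases le_or_gt p.natDegree q.natDegree with hle | hlt
  · refine Or.inr ⟨_, (top _ hle le_rfl).trans ?_⟩
    rw [coeff_natDegree, div_self hq0, mul_one]
  · have hp : p ≠ 0 := by rintro rfl; simp at hlt
    refine Or.inl ⟨_, div_ne_zero (leadingCoeff_ne_zero.mpr hp) hq0,
      (top _ le_rfl hlt.le).trans ?_⟩
    rw [coeff_eq_zero_of_natDegree_lt hlt, zero_div, mul_zero, add_zero, coeff_natDegree]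

/-- The restriction of `τ` to `k(a)`, when `τ` stabilizes `k` and `τ a = a + f` with `f` in `k`. -/
theorem exists_restrict_adjoin {k L : Type*} [Field k] [Field L] [Algebra k L]
    (σ : k →+* k) (τ : L →+* L) (hστ : ∀ x, τ (algebraMap k L x) = algebraMap k L (σ x))
    {a : L} {f : k} (ha : τ a = a + algebraMap k L f) :
    ∃ ρ : IntermediateField.adjoin k {a} →+* IntermediateField.adjoin k {a},
      ∀ x : IntermediateField.adjoin k {a}, τ (x : L) = ρ x := by
  have hmem : ∀ x : IntermediateField.adjoin k {a}, τ x ∈ IntermediateField.adjoin k {a} := by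
    intro x
    obtain ⟨p, q, hx⟩ := (IntermediateField.mem_adjoin_simple_iff k (x : L)).mp x.2
    rw [hx, map_div₀, map_aeval_eq_aeval_taylor σ τ hστ ha, map_aeval_eq_aeval_taylor σ τ hστ ha]
    exact (IntermediateField.mem_adjoin_simple_iff k _).mpr ⟨_, _, rfl⟩
  exact ⟨(τ.comp (algebraMap (IntermediateField.adjoin k {a}) L)).codRestrict
    (IntermediateField.adjoin k {a}) hmem, fun _ => rfl⟩

/-- A nonzero solution of `τ b = u * b` in an algebraic extension of `k(a)` yields a nonzero
solution in `k` of `σ c = u ^ n * c` for some positive `n`. -/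
theorem exists_multiplicative_solution {k L : Type*} [Field k] [Field L] [Algebra k L]
    (σ : k →+* k) (τ : L →+* L) (hστ : ∀ x, τ (algebraMap k L x) = algebraMap k L (σ x))
    {a : L} (hat : Transcendental k a) {f : k} (ha : τ a = a + algebraMap k L f)
    [Algebra.IsAlgebraic (IntermediateField.adjoin k {a}) L]
    {u : k} (hu : u ≠ 0) {b : L} (hb0 : b ≠ 0) (h : τ b = algebraMap k L u * b) :
    ∃ n : ℕ, n ≠ 0 ∧ ∃ c : k, c ≠ 0 ∧ σ c = u ^ n * c := by
  obtain ⟨ρ, hρ⟩ := exists_restrict_adjoin σ τ hστ ha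
  obtain ⟨n, hn, c, hc0, hc⟩ := exists_base_multiplicative_solution ρ τ hρ
    (Algebra.IsAlgebraic.isAlgebraic b).isIntegral hb0
    (u := algebraMap k (IntermediateField.adjoin k {a}) u) ((map_ne_zero _).mpr hu) h
  refine ⟨n, hn, exists_multiplicative_solution_of_mem_adjoin σ τ hστ hat ha c.2
    (by simpa using hc0) ?_⟩
  rw [hρ, hc, map_pow]
  rfl

/-- A solution of `τ b = u * b + v` in an algebraic extension of `k(a)` yields a solution in `k` of
this equation or a nonzero solution of the associated homogeneous one. -/
theorem exists_affine_solution {k L : Type*} [Field k] [CharZero k] [Field L] [Algebra k L]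
    (σ : k →+* k) (τ : L →+* L) (hστ : ∀ x, τ (algebraMap k L x) = algebraMap k L (σ x))
    {a : L} (hat : Transcendental k a) {f : k} (ha : τ a = a + algebraMap k L f)
    [Algebra.IsAlgebraic (IntermediateField.adjoin k {a}) L]
    {u v : k} (hu : u ≠ 0) {b : L} (h : τ b = algebraMap k L u * b + algebraMap k L v) :
    (∃ c : k, c ≠ 0 ∧ σ c = u * c) ∨ ∃ c : k, σ c = u * c + v := by
  obtain ⟨ρ, hρ⟩ := exists_restrict_adjoin σ τ hστ ha
  have : CharZero (IntermediateField.adjoin k {a}) :=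
    charZero_of_injective_algebraMap (algebraMap k (IntermediateField.adjoin k {a})).injective
  obtain ⟨c, hc⟩ := exists_base_affine_solution ρ τ hρ
    (Algebra.IsAlgebraic.isAlgebraic b).isIntegral
    (u := algebraMap k (IntermediateField.adjoin k {a}) u)
    (v := algebraMap k (IntermediateField.adjoin k {a}) v) ((map_ne_zero _).mpr hu) h
  refine exists_solution_of_mem_adjoin σ τ hστ hat ha c.2 ?_
  rw [hρ, hc]
  rfl


/-- Avoidance of multiplicative equations `σ(x) = e^z·x` and of the twisted σ-AS
equations `σ(x) - e·x = e` and `σ(x) - e⁻¹·x = e⁻¹` passes from a subfield `E` of a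
characteristic-zero field `L` to `L` itself, provided `L` is algebraic over `E(a)`
for some `a` transcendental over `E` with `τ(a) = a + f`, `f ∈ E`, where `τ` is an
automorphism of `L` mapping `E` onto itself. -/
theorem avoidance_extends_along_sigmaAS_generator
    {L : Type*} [Field L] [CharZero L]
    (E : Subfield L) (a : L)
    (htrans : Transcendental E a)
    (halg : Algebra.IsAlgebraic (IntermediateField.adjoin E {a}) L)
    (τ : L ≃+* L) (hE : E.map (τ : L →+* L) = E)
    (f : L) (hf : f ∈ E) (hτa : τ a = a + f)
    (e : L) (heE : e ∈ E) (he : e ≠ 0)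
    (h1 : ∀ z : ℤ, z ≠ 0 → ¬ ∃ c ∈ E, c ≠ 0 ∧ τ c = e ^ z * c)
    (h2 : ¬ ∃ c ∈ E, τ c - e * c = e)
    (h3 : ¬ ∃ c ∈ E, τ c - e⁻¹ * c = e⁻¹) :
    (∀ z : ℤ, z ≠ 0 → ¬ ∃ b : L, b ≠ 0 ∧ τ b = e ^ z * b) ∧
    (¬ ∃ b : L, τ b - e * b = e) ∧
    (¬ ∃ b : L, τ b - e⁻¹ * b = e⁻¹) := by
  have hmem : ∀ x : E, τ x ∈ E := fun x => by
    have : τ (x : L) ∈ E.map (τ : L →+* L) := ⟨x, x.2, rfl⟩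
    rwa [hE] at this
  let σ : E →+* E := ((τ : L →+* L).comp E.subtype).codRestrict E hmem
  have hστ : ∀ x : E, (τ : L →+* L) (algebraMap E L x) = algebraMap E L (σ x) := fun _ => rfl
  have ha : (τ : L →+* L) a = a + algebraMap E L ⟨f, hf⟩ := hτa
  have : CharZero E := charZero_of_injective_algebraMap (algebraMap ℚ E).injective
  have affine : ∀ z : ℤ, z ≠ 0 → (¬ ∃ c ∈ E, τ c - e ^ z * c = e ^ z) →
      ¬ ∃ b : L, τ b - e ^ z * b = e ^ z := by
    rintro z hz hno ⟨b, hb⟩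
    have hu : (⟨e ^ z, zpow_mem heE z⟩ : E) ≠ 0 := fun h0 =>
      zpow_ne_zero z he (congrArg Subtype.val h0)
    rcases exists_affine_solution σ τ hστ htrans ha hu (v := ⟨e ^ z, zpow_mem heE z⟩) (b := b)
      (eq_add_of_sub_eq' hb) with ⟨c, hc0, hc⟩ | ⟨c, hc⟩
    · exact h1 z hz ⟨c, c.2, by simpa using hc0, congrArg Subtype.val hc⟩
    · exact hno ⟨c, c.2, sub_eq_of_eq_add' (congrArg Subtype.val hc)⟩
  refine ⟨?_, by simpa using affine 1 one_ne_zero (by simpa using h2),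
    by simpa using affine (-1) (by decide) (by simpa using h3)⟩
  rintro z hz ⟨b, hb0, hb⟩
  have hu : (⟨e ^ z, zpow_mem heE z⟩ : E) ≠ 0 := fun h0 =>
    zpow_ne_zero z he (congrArg Subtype.val h0)
  obtain ⟨n, hn, c, hc0, hc⟩ := exists_multiplicative_solution σ τ hστ htrans ha hu hb0 hb
  refine h1 (z * n) (mul_ne_zero hz (by exact_mod_cast hn)) ⟨c, c.2, by simpa using hc0, ?_⟩
  rw [zpow_mul, zpow_natCast]
  exact congrArg Subtype.val hc
end

section
/- Let E be a field of characteristic 0, σ₀ : E → E a field automorphism, and e ∈ E with e ≠ 0. Let σ̂ be a field automorphism of the rational function field E(X) such that σ̂(C(c)) = C(σ₀(c)) for all c ∈ E and σ̂(X) = C(e)·X + C(e), where C : E → E(X) is the constant embedding and X the distinguished generator. Assume: (i) for every integer z ≠ 0 there is no c ∈ E ∖ {0} with σ₀(c) = e^z·c; and (ii) there is no c ∈ E with σ₀(c) − e⁻¹·c = e⁻¹. Then there is no b ∈ E(X) with σ̂(b) − b = X. -/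
open Polynomial in
/-- An endomorphism of `E(X)` that extends `σ₀` and maps `X` to the polynomial `g` sends a
polynomial `p` to the composition of `p.map σ₀` with `g`. -/
theorem RatFunc.ringHom_algebraMap_eq_comp {E : Type*} [Field E] (σ₀ : E →+* E)
    (σ : RatFunc E →+* RatFunc E) (g : E[X])
    (hC : ∀ c, σ (RatFunc.C c) = RatFunc.C (σ₀ c))
    (hX : σ RatFunc.X = algebraMap E[X] (RatFunc E) g) (p : E[X]) :
    σ (algebraMap E[X] (RatFunc E) p) =
      algebraMap E[X] (RatFunc E) ((p.map σ₀).comp g) := by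
  induction p using Polynomial.induction_on' with
  | add p q hp hq => simp [hp, hq]
  | monomial n a =>
    simp [← Polynomial.C_mul_X_pow_eq_monomial, RatFunc.algebraMap_C, RatFunc.algebraMap_X, hC, hX]

open Polynomial in
/-- Degree comparison at infinity for the difference equation `P / Q - p / q = X`, where the
numerators and the denominators have equal degrees. -/
theorem Polynomial.exists_leadingCoeff_relation_of_sub_eq_X_mul {E : Type*} [Field E]
    {p q P Q : E[X]} (hq : q.Monic) (hQ : Q ≠ 0) (hp : P.natDegree = p.natDegree)
    (hqQ : Q.natDegree = q.natDegree) (h : P * q - p * Q = X * (q * Q)) :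
    (q.natDegree + 1 < p.natDegree ∧
        P.leadingCoeff = p.leadingCoeff * Q.leadingCoeff) ∨
      (p.natDegree = q.natDegree + 1 ∧
        P.leadingCoeff - p.leadingCoeff * Q.leadingCoeff = Q.leadingCoeff) := by
  have hPq : (P * q).coeff (p.natDegree + q.natDegree) = P.leadingCoeff := by
    rw [← hp, coeff_mul_degree_add_degree, hq.leadingCoeff, mul_one]
  have hpQ : (p * Q).coeff (p.natDegree + q.natDegree) = p.leadingCoeff * Q.leadingCoeff := by
    rw [← hqQ, coeff_mul_degree_add_degree]
  have hqQ' : (q * Q).coeff (q.natDegree + q.natDegree) = Q.leadingCoeff := by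
    simpa only [hqQ, hq.leadingCoeff, one_mul] using coeff_mul_degree_add_degree q Q
  have hdeg : (q * Q).natDegree = q.natDegree + q.natDegree := by
    rw [hq.natDegree_mul' hQ, hqQ]
  rcases lt_trichotomy p.natDegree (q.natDegree + 1) with hlt | heq | hgt
  · have hc := congrArg (fun r => r.coeff (q.natDegree + q.natDegree + 1)) h
    have h1 : (P * q).coeff (q.natDegree + q.natDegree + 1) = 0 :=
      coeff_eq_zero_of_natDegree_lt (natDegree_mul_le.trans_lt (by omega))
    have h2 : (p * Q).coeff (q.natDegree + q.natDegree + 1) = 0 :=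
      coeff_eq_zero_of_natDegree_lt (natDegree_mul_le.trans_lt (by omega))
    simp only [coeff_sub, h1, h2, coeff_X_mul, hqQ', sub_zero] at hc
    exact absurd hc.symm (leadingCoeff_ne_zero.mpr hQ)
  · have hc := congrArg (fun r => r.coeff (p.natDegree + q.natDegree)) h
    simp only [coeff_sub, hPq, hpQ] at hc
    rw [heq, add_right_comm, coeff_X_mul, hqQ'] at hc
    exact Or.inr ⟨heq, hc⟩
  · have hc := congrArg (fun r => r.coeff (p.natDegree + q.natDegree)) h
    have h0 : (X * (q * Q)).coeff (p.natDegree + q.natDegree) = 0 :=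
      coeff_eq_zero_of_natDegree_lt
        (natDegree_mul_le.trans_lt (by rw [hdeg, natDegree_X]; omega))
    simp only [coeff_sub, hPq, hpQ, h0] at hc
    exact Or.inl ⟨hgt, sub_eq_zero.mp hc⟩


/-- Let `σhat` be an automorphism of the rational function field `E(X)` extending
an automorphism `σ₀` of `E` and sending `X` to `C(e)·X + C(e)` with `e ≠ 0`.
If no nonzero `c ∈ E` satisfies `σ₀(c) = e^z·c` for any nonzero integer `z`, and no
`c ∈ E` satisfies `σ₀(c) - e⁻¹·c = e⁻¹`, then the σ-AS equation `σhat(b) - b = X`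
has no solution `b ∈ E(X)`. -/
theorem sigmaAS_torsor_of_twisted_generator_not_solvable
    {E : Type*} [Field E] [CharZero E]
    (σ₀ : E ≃+* E) (e : E) (he : e ≠ 0)
    (σhat : RatFunc E ≃+* RatFunc E)
    (hC : ∀ c : E, σhat (RatFunc.C c) = RatFunc.C (σ₀ c))
    (hX : σhat RatFunc.X = RatFunc.C e * RatFunc.X + RatFunc.C e)
    (h1 : ∀ z : ℤ, z ≠ 0 → ¬ ∃ c : E, c ≠ 0 ∧ σ₀ c = e ^ z * c)
    (h2 : ¬ ∃ c : E, σ₀ c - e⁻¹ * c = e⁻¹) :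
    ¬ ∃ b : RatFunc E, σhat b - b = RatFunc.X := by
  rintro ⟨b, hb⟩
  set g : Polynomial E := Polynomial.C e * Polynomial.X + Polynomial.C e with hg
  have hgdeg : g.natDegree = 1 := Polynomial.natDegree_linear he
  have hglead : g.leadingCoeff = e := Polynomial.leadingCoeff_linear he
  have hσ := RatFunc.ringHom_algebraMap_eq_comp (σ₀ : E →+* E)
    (σhat : RatFunc E →+* RatFunc E) g (by simpa using hC)
    (by simp [hX, hg, RatFunc.algebraMap_C, RatFunc.algebraMap_X])
  set S : Polynomial E → Polynomial E := fun p => (p.map (σ₀ : E →+* E)).comp g with hS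
  have hdeg (p : Polynomial E) : (S p).natDegree = p.natDegree := by
    simp [hS, Polynomial.natDegree_comp, hgdeg]
  have hlead (p : Polynomial E) :
      (S p).leadingCoeff = σ₀ p.leadingCoeff * e ^ p.natDegree := by
    simp [hS, Polynomial.leadingCoeff_comp (hgdeg.trans_ne one_ne_zero), hglead]
  have hq : b.denom.Monic := b.monic_denom
  have hleadq : (S b.denom).leadingCoeff = e ^ b.denom.natDegree := by
    rw [hlead, hq.leadingCoeff, map_one, one_mul]
  have hQ : S b.denom ≠ 0 := by
    rw [← Polynomial.leadingCoeff_ne_zero, hleadq]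
    exact pow_ne_zero _ he
  have hpoly : S b.num * b.denom - b.num * S b.denom
      = Polynomial.X * (b.denom * S b.denom) := by
    apply RatFunc.algebraMap_injective E
    have hb' := hb
    rw [← RatFunc.num_div_denom b, map_div₀] at hb'
    have hn := hσ b.num
    have hd := hσ b.denom
    simp only [RingEquiv.coe_toRingHom] at hn hd
    rw [hn, hd, div_sub_div _ _ (RatFunc.algebraMap_ne_zero hQ)
      (RatFunc.algebraMap_ne_zero hq.ne_zero), div_eq_iff (mul_ne_zero
      (RatFunc.algebraMap_ne_zero hQ) (RatFunc.algebraMap_ne_zero hq.ne_zero))] at hb'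
    simp only [map_sub, map_mul, RatFunc.algebraMap_X]
    linear_combination hb'
  rcases Polynomial.exists_leadingCoeff_relation_of_sub_eq_X_mul hq hQ (hdeg _) (hdeg _) hpoly
    with ⟨hlt, h⟩ | ⟨heq, h⟩
  · rw [hlead, hleadq] at h
    refine h1 ((b.denom.natDegree : ℤ) - b.num.natDegree) (by omega)
      ⟨b.num.leadingCoeff, ?_, ?_⟩
    · rw [Polynomial.leadingCoeff_ne_zero]
      rintro h0
      simp [h0] at hlt
    · rw [zpow_sub₀ he, zpow_natCast, zpow_natCast]
      field_simp
      linear_combination h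
  · rw [hlead, hleadq, heq, pow_succ] at h
    refine h2 ⟨b.num.leadingCoeff, ?_⟩
    field_simp
    apply mul_left_cancel₀ (pow_ne_zero b.denom.natDegree he)
    linear_combination h
end

section
/- Let L be a field of characteristic 0, E a subfield of L, and a ∈ L transcendental over E such that L is algebraic over the subfield E(a) generated by E and a. Let τ : L → L be a field automorphism with τ(E) = E, write σ₀ for the restriction of τ to E, and assume τ(a) = e·a + e for some e ∈ E with e ≠ 0. Assume: (i) for every integer z ≠ 0 there is no c ∈ E ∖ {0} with σ₀(c) = e^z·c; and (ii) there is no c ∈ E with σ₀(c) − e⁻¹·c = e⁻¹. Then there is no b ∈ L with τ(b) − b = a. -/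
open Polynomial in
theorem Polynomial.Monic.nextCoeff_taylor {R : Type*} [CommRing R] {p : R[X]} (hp : p.Monic)
    (r : R) : (taylor r p).nextCoeff = p.nextCoeff + p.natDegree * r := by
  rcases Nat.eq_zero_or_pos p.natDegree with h | h
  · rw [(nextCoeff_eq_zero).2 (Or.inl (by rw [natDegree_taylor, h])),
      (nextCoeff_eq_zero).2 (Or.inl h), h]
    simp
  · obtain ⟨n, hn⟩ := Nat.exists_eq_succ_of_ne_zero h.ne'
    have hdeg : (hasseDeriv n p).natDegree < 2 := by
      have := natDegree_hasseDeriv_le p n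
      omega
    have hlead : p.coeff (n + 1) = 1 := by
      rw [← Nat.succ_eq_add_one, ← hn]
      exact hp
    rw [nextCoeff_of_natDegree_pos (by rwa [natDegree_taylor]), nextCoeff_of_natDegree_pos h,
      natDegree_taylor, taylor_coeff, hn, Nat.succ_sub_one, eval_eq_sum_range' hdeg]
    simp [Finset.sum_range_succ, hasseDeriv_coeff, hlead, add_comm 1 n]

/-- In characteristic zero, a solution of a `σ`-AS equation that is algebraic over the base
difference field yields, by averaging its conjugates, a solution in the base field. -/
theorem exists_sub_eq_of_isIntegral {K L : Type*} [Field K] [Field L] [CharZero K] [Algebra K L]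
    (σ : K →+* K) (τ : L →+* L) (hστ : ∀ x, τ (algebraMap K L x) = algebraMap K L (σ x))
    {a : K} {b : L} (hint : IsIntegral K b) (hb : τ b - b = algebraMap K L a) :
    ∃ c : K, σ c - c = a := by
  open Polynomial in
  set p := minpoly K b
  have hmonic : p.Monic := minpoly.monic hint
  have hroot : aeval b (taylor a (p.map σ)) = 0 := by
    have hcomp : (algebraMap K L).comp σ = τ.comp (algebraMap K L) :=
      RingHom.ext fun x => (hστ x).symm
    have hτb : b + algebraMap K L a = τ b := by rw [← hb]; ring
    rw [taylor_apply, aeval_comp, map_add, aeval_X, aeval_C, hτb, aeval_def, eval₂_map, hcomp,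
      ← hom_eval₂, ← aeval_def, minpoly.aeval, map_zero]
  have heq : taylor a (p.map σ) = p := by
    refine minpoly.unique_of_degree_le_degree_minpoly K b ?_ hroot ?_
    · rw [Monic, leadingCoeff_taylor]
      exact hmonic.map σ
    · rw [degree_taylor, degree_map]
  have hnext : σ p.nextCoeff + p.natDegree * a = p.nextCoeff := by
    have := (hmonic.map σ).nextCoeff_taylor a
    rwa [heq, nextCoeff_map_eq, natDegree_map, eq_comm] at this
  have hn : (p.natDegree : K) ≠ 0 := Nat.cast_ne_zero.2 (minpoly.natDegree_pos hint).ne'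
  refine ⟨-p.nextCoeff / p.natDegree, ?_⟩
  rw [map_div₀, map_neg, map_natCast]
  field_simp
  linear_combination -hnext

open Polynomial in
/-- The equation `σ(f) - f = X`, cleared of denominators, has no solution `f = p / q` in the
rational function field `F(X)` with `σ(X) = e * X + e`. -/
theorem Polynomial.map_comp_mul_sub_ne {F : Type*} [Field F] (σ : F →+* F) {e : F} (he : e ≠ 0)
    (h1 : ∀ z : ℤ, z ≠ 0 → ∀ c : F, c ≠ 0 → σ c ≠ e ^ z * c)
    (h2 : ∀ c : F, σ c - e⁻¹ * c ≠ e⁻¹) (p : F[X]) {q : F[X]} (hq : q ≠ 0) :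
    (p.map σ).comp (C e * X + C e) * q - p * (q.map σ).comp (C e * X + C e) ≠
      X * (q * (q.map σ).comp (C e * X + C e)) := by
  intro h
  set g : F[X] := C e * X + C e with hg
  have hgdeg : g.natDegree = 1 := natDegree_linear he
  have hglead : g.leadingCoeff = e := leadingCoeff_linear he
  have hdeg (f : F[X]) : ((f.map σ).comp g).natDegree = f.natDegree := by
    rw [natDegree_comp, natDegree_map, hgdeg, mul_one]
  have hcoeff (f : F[X]) : ((f.map σ).comp g).coeff f.natDegree =
      σ f.leadingCoeff * e ^ f.natDegree := by
    conv_lhs => rw [← hdeg f]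
    rw [coeff_natDegree, leadingCoeff_comp (by simp [hgdeg]), hglead, leadingCoeff_map,
      natDegree_map]
  have hlq : q.leadingCoeff ≠ 0 := leadingCoeff_ne_zero.2 hq
  have hσq : σ q.leadingCoeff ≠ 0 := (_root_.map_ne_zero σ).2 hlq
  have hleft : ((p.map σ).comp g * q).coeff (p.natDegree + q.natDegree) =
      σ p.leadingCoeff * e ^ p.natDegree * q.leadingCoeff := by
    rw [coeff_mul_add_eq_of_natDegree_le (hdeg p).le le_rfl, hcoeff, coeff_natDegree]
  have hmid : (p * (q.map σ).comp g).coeff (p.natDegree + q.natDegree) =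
      p.leadingCoeff * (σ q.leadingCoeff * e ^ q.natDegree) := by
    rw [coeff_mul_add_eq_of_natDegree_le le_rfl (hdeg q).le, hcoeff, coeff_natDegree]
  have hright : (q * (q.map σ).comp g).coeff (q.natDegree + q.natDegree) =
      q.leadingCoeff * (σ q.leadingCoeff * e ^ q.natDegree) := by
    rw [coeff_mul_add_eq_of_natDegree_le le_rfl (hdeg q).le, hcoeff, coeff_natDegree]
  have hrightdeg : (q * (q.map σ).comp g).natDegree ≤ q.natDegree + q.natDegree :=
    natDegree_mul_le_of_le le_rfl (hdeg q).le
  rcases lt_trichotomy p.natDegree (q.natDegree + 1) with hlt | heq | hgt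
  · have hc := congrArg (fun f => f.coeff (q.natDegree + q.natDegree + 1)) h
    simp only [coeff_sub, coeff_X_mul, hright] at hc
    rw [coeff_eq_zero_of_natDegree_lt, coeff_eq_zero_of_natDegree_lt, sub_zero] at hc
    · exact mul_ne_zero hlq (mul_ne_zero hσq (pow_ne_zero _ he)) hc.symm
    · exact (natDegree_mul_le_of_le le_rfl (hdeg q).le).trans_lt (by omega)
    · exact (natDegree_mul_le_of_le (hdeg p).le le_rfl).trans_lt (by omega)
  · have hc := congrArg (fun f => f.coeff (p.natDegree + q.natDegree)) h
    simp only [coeff_sub, hleft, hmid] at hc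
    rw [heq, show q.natDegree + 1 + q.natDegree = q.natDegree + q.natDegree + 1 by omega,
      coeff_X_mul, hright] at hc
    refine h2 (p.leadingCoeff / q.leadingCoeff) ?_
    rw [map_div₀]
    have hpow : e ^ q.natDegree ≠ 0 := pow_ne_zero _ he
    field_simp
    refine mul_left_cancel₀ hpow ?_
    linear_combination hc
  · have hc := congrArg (fun f => f.coeff (p.natDegree + q.natDegree)) h
    simp only [coeff_sub, hleft, hmid] at hc
    rw [show p.natDegree + q.natDegree = p.natDegree + q.natDegree - 1 + 1 by omega, coeff_X_mul,
      coeff_eq_zero_of_natDegree_lt (hrightdeg.trans_lt (by omega))] at hc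
    have hp : p ≠ 0 := by
      rintro rfl
      simp at hgt
    refine h1 (q.natDegree - p.natDegree) (by omega) (p.leadingCoeff / q.leadingCoeff)
      (div_ne_zero (leadingCoeff_ne_zero.2 hp) hlq) ?_
    rw [map_div₀, zpow_sub₀ he, zpow_natCast, zpow_natCast]
    field_simp
    linear_combination hc

/-- Let `L` be a characteristic-zero field, `E` a subfield, `a ∈ L` transcendental
over `E` with `L` algebraic over `E(a)`, and `τ` an automorphism of `L` mapping `E`
onto itself with `τ(a) = e·a + e`, `e ∈ E`, `e ≠ 0`. If no nonzero `c ∈ E` satisfies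
`τ(c) = e^z·c` for any nonzero integer `z`, and no `c ∈ E` satisfies
`τ(c) - e⁻¹·c = e⁻¹`, then the torsor `𝔗_a`, i.e. the equation `τ(b) - b = a`,
is not realised in `L`. -/
theorem torsor_of_twisted_generator_not_realised
    {L : Type*} [Field L] [CharZero L]
    (E : Subfield L) (a : L)
    (htrans : Transcendental E a)
    (halg : Algebra.IsAlgebraic (IntermediateField.adjoin E {a}) L)
    (τ : L ≃+* L) (hE : E.map (τ : L →+* L) = E)
    (e : L) (heE : e ∈ E) (he : e ≠ 0)
    (hτa : τ a = e * a + e)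
    (h1 : ∀ z : ℤ, z ≠ 0 → ¬ ∃ c ∈ E, c ≠ 0 ∧ τ c = e ^ z * c)
    (h2 : ¬ ∃ c ∈ E, τ c - e⁻¹ * c = e⁻¹) :
    ¬ ∃ b : L, τ b - b = a := by
  open Polynomial IntermediateField in
  rintro ⟨b, hb⟩
  have hτE : ∀ x ∈ E, τ x ∈ E := fun x hx => by
    rw [← hE]
    exact ⟨x, hx, rfl⟩
  let σ : E →+* E := ((τ : L →+* L).comp E.subtype).codRestrict E fun x => hτE x x.2
  let e' : E := ⟨e, heE⟩
  have he' : e' ≠ 0 := fun h => he (congrArg Subtype.val h)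
  have hτaeval (p : E[X]) : τ (aeval a p) = aeval a ((p.map σ).comp (C e' * X + C e')) := by
    have hg : aeval a (C e' * X + C e') = τ a := by
      rw [hτa, map_add, map_mul, aeval_X, aeval_C]
      rfl
    have hcomp : (algebraMap E L).comp σ = (τ : L →+* L).comp (algebraMap E L) := rfl
    rw [aeval_comp, hg, aeval_def, aeval_def, eval₂_map, hcomp]
    exact hom_eval₂ p (algebraMap E L) (τ : L →+* L) a
  have hτK : ∀ x ∈ adjoin E {a}, τ x ∈ adjoin E {a} := fun x hx => by
    obtain ⟨r, s, rfl⟩ := (mem_adjoin_simple_iff E x).1 hx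
    rw [map_div₀, hτaeval, hτaeval]
    exact (mem_adjoin_simple_iff E _).2 ⟨_, _, rfl⟩
  let τK : adjoin E {a} →+* adjoin E {a} :=
    ((τ : L →+* L).comp (algebraMap (adjoin E {a}) L)).codRestrict (adjoin E {a})
      fun x => hτK x x.2
  obtain ⟨⟨c, hcK⟩, hc⟩ := exists_sub_eq_of_isIntegral (a := ⟨a, mem_adjoin_simple_self E a⟩)
    τK (τ : L →+* L) (fun _ => rfl) (halg.isAlgebraic b).isIntegral hb
  replace hc : τ c - c = a := congrArg Subtype.val hc
  obtain ⟨p, q, rfl⟩ := (mem_adjoin_simple_iff E c).1 hcK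
  have hinj : Function.Injective (aeval a : E[X] → L) :=
    transcendental_iff_injective.1 htrans
  have hq : q ≠ 0 := by
    rintro rfl
    have ha : a = 0 := by simpa using hc.symm
    exact htrans (ha ▸ isAlgebraic_zero)
  have hqa : aeval a q ≠ 0 := fun h => hq (hinj (by rw [h, map_zero]))
  have hτqa : τ (aeval a q) ≠ 0 := (map_ne_zero τ).2 hqa
  refine Polynomial.map_comp_mul_sub_ne σ he' ?_ ?_ p hq (hinj ?_)
  · intro z hz d hd h
    refine h1 z hz ⟨d, d.2, fun h0 => hd (Subtype.ext h0), ?_⟩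
    have hval : τ d = ((e' ^ z * d : E) : L) := congrArg Subtype.val h
    rw [hval]
    push_cast
    rfl
  · intro d h
    exact h2 ⟨d, d.2, congrArg Subtype.val h⟩
  · rw [map_sub, map_mul, map_mul, map_mul, map_mul, aeval_X, ← hτaeval, ← hτaeval]
    rw [map_div₀] at hc
    field_simp at hc
    linear_combination hc
end

section
/- Let K be a field of characteristic 0 with a field automorphism σ : K → K, and let F = {x ∈ K : σ(x) = x} be the fixed field of σ. Let E ⊆ A₁ and E ⊆ A₂ be subfields of K, each closed under σ and σ⁻¹, with A₁ ∩ A₂ = E. Assume E is σ-AS-closed, i.e., for every a ∈ E there exists b ∈ E with σ(b) − b = a. Then the intersection of F with the ℚ-linear span of A₁ ∪ A₂ inside K equals the ℚ-linear span of (A₁ ∩ F) ∪ (A₂ ∩ F); equivalently, whenever a₁ ∈ A₁ and a₂ ∈ A₂ satisfy a₁ + a₂ ∈ F, there exist f₁ ∈ A₁ ∩ F and f₂ ∈ A₂ ∩ F with a₁ + a₂ = f₁ + f₂. -/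
/-- A subfield of a field of characteristic zero, as a `ℚ`-linear subspace. -/
def Subfield.toRatSubmodule {K : Type*} [Field K] [CharZero K] (A : Subfield K) :
    Submodule ℚ K where
  carrier := A
  add_mem' := A.add_mem
  zero_mem' := A.zero_mem
  smul_mem' q x hx := by
    rw [Rat.smul_def]
    exact A.mul_mem (SubfieldClass.ratCast_mem A q) hx

theorem exists_fixed_add_fixed_of_add_fixed {K : Type*} [Field K] (σ : K ≃+* K)
    {E A₁ A₂ : Subfield K} (hEA₁ : E ≤ A₁) (hEA₂ : E ≤ A₂)
    (hA₁σ : ∀ x ∈ A₁, σ x ∈ A₁) (hA₂σ : ∀ x ∈ A₂, σ x ∈ A₂) (hinter : A₁ ⊓ A₂ = E)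
    (hAS : ∀ a ∈ E, ∃ b ∈ E, σ b - b = a) {a₁ a₂ : K} (h₁ : a₁ ∈ A₁) (h₂ : a₂ ∈ A₂)
    (h : σ (a₁ + a₂) = a₁ + a₂) :
    ∃ f₁ f₂ : K, f₁ ∈ A₁ ∧ σ f₁ = f₁ ∧ f₂ ∈ A₂ ∧ σ f₂ = f₂ ∧ a₁ + a₂ = f₁ + f₂ := by
  rw [map_add] at h
  have hdiff : σ a₁ - a₁ = a₂ - σ a₂ := by linear_combination h
  have hE : σ a₁ - a₁ ∈ E := by
    rw [← hinter]
    exact ⟨A₁.sub_mem (hA₁σ _ h₁) h₁, hdiff ▸ A₂.sub_mem h₂ (hA₂σ _ h₂)⟩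
  obtain ⟨b, hb, hσb⟩ := hAS _ hE
  refine ⟨a₁ - b, a₂ + b, A₁.sub_mem h₁ (hEA₁ hb), ?_, A₂.add_mem h₂ (hEA₂ hb), ?_, by ring⟩
  · rw [map_sub]
    linear_combination -hσb
  · rw [map_add]
    linear_combination hσb + hdiff


/-- If `E` is a σ-AS-closed common subfield of two σ-invariant subfields `A₁, A₂`
of a characteristic-zero difference field `(K, σ)` with `A₁ ∩ A₂ = E`, then the
intersection of the fixed field `F = {x | σ x = x}` with the ℚ-linear span of
`A₁ ∪ A₂` equals the ℚ-linear span of `(A₁ ∩ F) ∪ (A₂ ∩ F)`; equivalently,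
whenever `a₁ ∈ A₁`, `a₂ ∈ A₂` and `a₁ + a₂ ∈ F`, we can write
`a₁ + a₂ = f₁ + f₂` with `f₁ ∈ A₁ ∩ F` and `f₂ ∈ A₂ ∩ F`. -/
theorem sigmaAS_closed_fixedField_span
    {K : Type*} [Field K] [CharZero K]
    (σ : K ≃+* K) (E A₁ A₂ : Subfield K)
    (hEA₁ : E ≤ A₁) (hEA₂ : E ≤ A₂)
    (hA₁σ : ∀ x ∈ A₁, σ x ∈ A₁) (hA₁σ' : ∀ x ∈ A₁, σ.symm x ∈ A₁)
    (hA₂σ : ∀ x ∈ A₂, σ x ∈ A₂) (hA₂σ' : ∀ x ∈ A₂, σ.symm x ∈ A₂)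
    (hinter : A₁ ⊓ A₂ = E)
    (hAS : ∀ a ∈ E, ∃ b ∈ E, σ b - b = a) :
    ({x : K | σ x = x} ∩
        (Submodule.span ℚ ((A₁ : Set K) ∪ (A₂ : Set K)) : Set K)
      = (Submodule.span ℚ
          ({x : K | x ∈ A₁ ∧ σ x = x} ∪ {x : K | x ∈ A₂ ∧ σ x = x}) : Set K))
    ∧ (∀ a₁ ∈ A₁, ∀ a₂ ∈ A₂, σ (a₁ + a₂) = a₁ + a₂ →
        ∃ f₁ f₂ : K, f₁ ∈ A₁ ∧ σ f₁ = f₁ ∧ f₂ ∈ A₂ ∧ σ f₂ = f₂ ∧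
          a₁ + a₂ = f₁ + f₂) := by
  have key {a₁ a₂ : K} (h₁ : a₁ ∈ A₁) (h₂ : a₂ ∈ A₂) (h : σ (a₁ + a₂) = a₁ + a₂) :=
    exists_fixed_add_fixed_of_add_fixed σ hEA₁ hEA₂ hA₁σ hA₂σ hinter hAS h₁ h₂ h
  refine ⟨Set.Subset.antisymm ?_ ?_, fun _ h₁ _ h₂ h => key h₁ h₂ h⟩
  · rintro x ⟨hx, hspan⟩
    have hle : Submodule.span ℚ ((A₁ : Set K) ∪ A₂) ≤
        A₁.toRatSubmodule ⊔ A₂.toRatSubmodule :=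
      Submodule.span_le.2 (Set.union_subset
        (fun y hy => Submodule.mem_sup_left (show y ∈ A₁.toRatSubmodule from hy))
        (fun y hy => Submodule.mem_sup_right (show y ∈ A₂.toRatSubmodule from hy)))
    obtain ⟨a₁, h₁, a₂, h₂, rfl⟩ := Submodule.mem_sup.1 (hle hspan)
    obtain ⟨f₁, f₂, hf₁, hσf₁, hf₂, hσf₂, hsum⟩ := key h₁ h₂ hx
    rw [hsum]
    exact Submodule.add_mem _ (Submodule.subset_span (Or.inl ⟨hf₁, hσf₁⟩))
      (Submodule.subset_span (Or.inr ⟨hf₂, hσf₂⟩))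
  · refine Set.subset_inter ?_ (Submodule.span_mono (Set.union_subset_union
      (fun _ hy => hy.1) (fun _ hy => hy.1)))
    exact Submodule.span_le (p := (RingHom.eqLocusField (σ : K →+* K)
      (RingHom.id K)).toRatSubmodule).2
      (Set.union_subset (fun _ hy => hy.2) (fun _ hy => hy.2))
end
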